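/- arXiv:1711.03432 — 4 statements merged into one kernel-verified Lean document; each statement's English description precedes it below -/
import Mathlib

section
/- For every n ≥ 1, the map π from Γ_{n+1} to Γ_n deleting the last letter of a word is a 3-sheeted normal (Galois) covering of Schreier graphs of the Gupta–Sidki 3-group with Galois group ℤ/3ℤ. Precisely: (i) π(s(w)) = s(π(w)) for every generator s ∈ {a,a⁻¹,b,b⁻¹} and word w of length n+1; (ii) for each k ∈ ℤ/3ℤ the map σ_k sending u·x to u·((x+k) mod 3) satisfies s(σ_k(w)) = σ_k(s(w)) for every generator s and every word w of length n+1, so each σ_k is a graph automorphism of Γ_{n+1}; (iii) {σ_0,σ_1,σ_2} is a cyclic group of order 3 under composition satisfying π∘σ_k = π and acting simply transitively on each fiber π⁻¹(u) = {u·0, u·1, u·2}. -/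
/-- The generator `b` of the Gupta–Sidki 3-group: `b(xw)=((x+1) mod 3)·w`. -/
def gsB : List (Fin 3) → List (Fin 3)
  | [] => []
  | x :: w => (x + 1) :: w

/-- The inverse generator `b⁻¹`: `b⁻¹(xw)=((x-1) mod 3)·w`. -/
def gsBinv : List (Fin 3) → List (Fin 3)
  | [] => []
  | x :: w => (x - 1) :: w

/-- The generator `a`: `a(0w)=0·b(w)`, `a(1w)=1·b⁻¹(w)`, `a(2w)=2·a(w)`. -/
def gsA : List (Fin 3) → List (Fin 3)
  | [] => []
  | x :: w => if x = 0 then x :: gsB w else if x = 1 then x :: gsBinv w else x :: gsA w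

/-- The inverse generator `a⁻¹`: `a⁻¹(0w)=0·b⁻¹(w)`, `a⁻¹(1w)=1·b(w)`, `a⁻¹(2w)=2·a⁻¹(w)`. -/
def gsAinv : List (Fin 3) → List (Fin 3)
  | [] => []
  | x :: w => if x = 0 then x :: gsBinv w else if x = 1 then x :: gsB w else x :: gsAinv w

/-- The map `σ_k`, sending `u·x` to `u·((x+k) mod 3)`. -/
def shiftLast3 (k : Fin 3) (w : List (Fin 3)) : List (Fin 3) :=
  w.dropLast ++ [w.getLastD 0 + k]

/-- `s` extends to words with one more letter by translating that letter by an amount depending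
only on the preceding word. -/
def TranslatesLast (s : List (Fin 3) → List (Fin 3)) : Prop :=
  ∀ u, ∃ c : Fin 3, ∀ x, s (u ++ [x]) = s u ++ [x + c]

theorem translatesLast_gsB : TranslatesLast gsB := by
  rintro (_ | ⟨y, u⟩)
  · exact ⟨1, fun x => rfl⟩
  · exact ⟨0, fun x => by simp [gsB]⟩

theorem translatesLast_gsBinv : TranslatesLast gsBinv := by
  rintro (_ | ⟨y, u⟩)
  · exact ⟨-1, fun x => by simp [gsBinv, sub_eq_add_neg]⟩
  · exact ⟨0, fun x => by simp [gsBinv]⟩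

theorem translatesLast_gsA : TranslatesLast gsA := by
  intro u
  induction u with
  | nil => exact ⟨0, fun x => by simp [gsA, gsB, gsBinv]⟩
  | cons y u ih =>
    obtain ⟨c, hc⟩ := ih
    obtain ⟨d, hd⟩ := translatesLast_gsB u
    obtain ⟨e, he⟩ := translatesLast_gsBinv u
    refine ⟨if y = 0 then d else if y = 1 then e else c, fun x => ?_⟩
    simp only [List.cons_append, gsA, hc, hd, he]
    split_ifs <;> rfl

theorem translatesLast_gsAinv : TranslatesLast gsAinv := by
  intro u
  induction u with
  | nil => exact ⟨0, fun x => by simp [gsAinv, gsB, gsBinv]⟩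
  | cons y u ih =>
    obtain ⟨c, hc⟩ := ih
    obtain ⟨d, hd⟩ := translatesLast_gsBinv u
    obtain ⟨e, he⟩ := translatesLast_gsB u
    refine ⟨if y = 0 then d else if y = 1 then e else c, fun x => ?_⟩
    simp only [List.cons_append, gsAinv, hc, hd, he]
    split_ifs <;> rfl

theorem translatesLast_of_mem {s : List (Fin 3) → List (Fin 3)}
    (hs : s ∈ [gsA, gsAinv, gsB, gsBinv]) : TranslatesLast s := by
  simp only [List.mem_cons, List.not_mem_nil, or_false] at hs
  rcases hs with rfl | rfl | rfl | rfl
  exacts [translatesLast_gsA, translatesLast_gsAinv, translatesLast_gsB, translatesLast_gsBinv]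

theorem shiftLast3_append_singleton (k : Fin 3) (u : List (Fin 3)) (x : Fin 3) :
    shiftLast3 k (u ++ [x]) = u ++ [x + k] := by
  simp [shiftLast3]

theorem exists_eq_append_singleton {α : Type*} {n : ℕ} {w : List α} (hw : w.length = n + 1) :
    ∃ u x, w = u ++ [x] :=
  have h : w ≠ [] := List.ne_nil_of_length_eq_add_one hw
  ⟨w.dropLast, w.getLast h, (List.dropLast_append_getLast h).symm⟩

/-- For every `n ≥ 1`, deleting the last letter is a 3-sheeted normal (Galois) covering
`Γ_{n+1} → Γ_n` of Schreier graphs of the Gupta–Sidki 3-group, with Galois group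
`ℤ/3ℤ = {σ_0,σ_1,σ_2}` acting simply transitively on the fibers. -/
theorem guptaSidki_galois_covering (n : ℕ) (hn : 1 ≤ n) :
    (∀ s ∈ [gsA, gsAinv, gsB, gsBinv], ∀ w : List (Fin 3), w.length = n + 1 →
        (s w).dropLast = s w.dropLast) ∧
    (∀ k : Fin 3, ∀ s ∈ [gsA, gsAinv, gsB, gsBinv], ∀ w : List (Fin 3), w.length = n + 1 →
        s (shiftLast3 k w) = shiftLast3 k (s w)) ∧
    (∀ w : List (Fin 3), w.length = n + 1 → shiftLast3 0 w = w) ∧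
    (∀ j k : Fin 3, ∀ w : List (Fin 3), w.length = n + 1 →
        shiftLast3 j (shiftLast3 k w) = shiftLast3 (j + k) w) ∧
    (∀ k : Fin 3, k ≠ 0 → ∀ w : List (Fin 3), w.length = n + 1 → shiftLast3 k w ≠ w) ∧
    (∀ k : Fin 3, ∀ w : List (Fin 3), w.length = n + 1 →
        (shiftLast3 k w).dropLast = w.dropLast) ∧
    (∀ u : List (Fin 3), u.length = n → ∀ w : List (Fin 3),
        (w.length = n + 1 ∧ w.dropLast = u) ↔ ∃ x : Fin 3, w = u ++ [x]) ∧
    (∀ w w' : List (Fin 3), w.length = n + 1 → w'.length = n + 1 →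
        w.dropLast = w'.dropLast → ∃! k : Fin 3, shiftLast3 k w = w') := by
  refine ⟨fun s hs w hw => ?_, fun k s hs w hw => ?_, fun w hw => ?_, fun j k w hw => ?_,
    fun k hk w hw => ?_, fun k w hw => ?_, fun u hu w => ⟨?_, ?_⟩, fun w w' hw hw' h => ?_⟩
  · obtain ⟨u, x, rfl⟩ := exists_eq_append_singleton hw
    obtain ⟨c, hc⟩ := translatesLast_of_mem hs u
    simp [hc]
  · obtain ⟨u, x, rfl⟩ := exists_eq_append_singleton hw
    obtain ⟨c, hc⟩ := translatesLast_of_mem hs u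
    simp only [shiftLast3_append_singleton, hc, add_right_comm]
  · obtain ⟨u, x, rfl⟩ := exists_eq_append_singleton hw
    simp [shiftLast3_append_singleton]
  · obtain ⟨u, x, rfl⟩ := exists_eq_append_singleton hw
    simp only [shiftLast3_append_singleton, add_assoc, add_comm k]
  · obtain ⟨u, x, rfl⟩ := exists_eq_append_singleton hw
    simpa [shiftLast3_append_singleton] using hk
  · simp [shiftLast3]
  · rintro ⟨hw, rfl⟩
    obtain ⟨u, x, rfl⟩ := exists_eq_append_singleton hw
    exact ⟨x, by simp⟩
  · rintro ⟨x, rfl⟩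
    simp [hu]
  · obtain ⟨u, x, rfl⟩ := exists_eq_append_singleton hw
    obtain ⟨u', y, rfl⟩ := exists_eq_append_singleton hw'
    obtain rfl : u = u' := by simpa using h
    refine ⟨y - x, by simp [shiftLast3_append_singleton], fun k hk => ?_⟩
    obtain rfl : x + k = y := by simpa [shiftLast3_append_singleton] using hk
    simp
end

section
/- Consider the Hanoi Towers group H(3) with its Schreier graphs Γ₁ (vertex set {0,1,2}) and Γ₂ (vertex set {0,1,2}²), and let π: Γ₂ → Γ₁ delete the last letter of a word. Then π(s(w)) = s(π(w)) for every generator s ∈ {a,b,c} and every word w of length 2, so π is a 3-sheeted covering of Schreier graphs; however this covering is NOT normal: the only bijection σ of {0,1,2}² satisfying π∘σ = π and preserving adjacency of Γ₂ is the identity, so in particular no group of deck transformations acts transitively on the fibers of π. -/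
/-- The generator `a` of the Hanoi Towers group `H(3)`:
`a(0w)=0·a(w)`, `a(1w)=2·w`, `a(2w)=1·w`. -/
def hanA : List (Fin 3) → List (Fin 3)
  | [] => []
  | x :: w => if x = 0 then 0 :: hanA w else (-x) :: w

/-- The generator `b`: `b(1w)=1·b(w)`, `b(0w)=2·w`, `b(2w)=0·w`. -/
def hanB : List (Fin 3) → List (Fin 3)
  | [] => []
  | x :: w => if x = 1 then 1 :: hanB w else (2 - x) :: w

/-- The generator `c`: `c(2w)=2·c(w)`, `c(0w)=1·w`, `c(1w)=0·w`. -/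
def hanC : List (Fin 3) → List (Fin 3)
  | [] => []
  | x :: w => if x = 2 then 2 :: hanC w else (1 - x) :: w

/-- Adjacency in the Schreier graph of `H(3)`: distinct vertices `u, v` are adjacent
iff `s(u) = v` for some generator `s ∈ {a,b,c}`. -/
def hanAdj (u v : List (Fin 3)) : Prop :=
  u ≠ v ∧ ∃ s ∈ [hanA, hanB, hanC], s u = v

/-- Adjacency of level-2 vertices: either the first letters differ and the last letters agree,
or the first letters agree and the last letters are the two other letters. -/
theorem hanAdj_pair_iff : ∀ x y x' y' : Fin 3, hanAdj [x, y] [x', y'] ↔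
    (x ≠ x' ∧ y = y') ∨ (x = x' ∧ y ≠ y' ∧ x ≠ y ∧ x ≠ y') := by
  unfold hanAdj
  decide

theorem exists_ne_and_ne (x y : Fin 3) : ∃ z, z ≠ x ∧ z ≠ y := by
  decide +revert

theorem dropLast_generator_pair (x y : Fin 3) : ∀ s ∈ [hanA, hanB, hanC],
    (s [x, y]).dropLast = s [x] := by
  decide +revert

/-- Deleting the last letter is a 3-sheeted covering `Γ₂ → Γ₁` of Schreier graphs of
the Hanoi Towers group `H(3)` (it commutes with the generators, and the fiber over `u`
is `{u·0, u·1, u·2}`), but this covering is NOT normal: the only bijection `σ` of the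
level-2 vertices satisfying `π∘σ = π` and preserving adjacency of `Γ₂` is the
identity; in particular no group of deck transformations acts transitively on fibers. -/
theorem hanoi_covering_not_normal :
    (∀ s ∈ [hanA, hanB, hanC], ∀ w : List (Fin 3), w.length = 2 →
        (s w).dropLast = s w.dropLast) ∧
    (∀ u : List (Fin 3), u.length = 1 → ∀ w : List (Fin 3),
        (w.length = 2 ∧ w.dropLast = u) ↔ ∃ x : Fin 3, w = u ++ [x]) ∧
    (∀ σ : {w : List (Fin 3) // w.length = 2} ≃ {w : List (Fin 3) // w.length = 2},
        (∀ v, (σ v).val.dropLast = v.val.dropLast) →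
        (∀ u v, hanAdj u.val v.val ↔ hanAdj (σ u).val (σ v).val) →
        ∀ v, σ v = v) := by
  refine ⟨?_, ?_, ?_⟩
  · intro s hs w hw
    obtain ⟨x, y, rfl⟩ := List.length_eq_two.mp hw
    exact dropLast_generator_pair x y s hs
  · intro u hu w
    obtain ⟨t, rfl⟩ := List.length_eq_one_iff.mp hu
    constructor
    · rintro ⟨hw, h⟩
      obtain ⟨x, y, rfl⟩ := List.length_eq_two.mp hw
      exact ⟨y, by simpa using h⟩
    · rintro ⟨x, rfl⟩
      simp
  · intro σ hπ hadj
    have last_letter (x y : Fin 3) : ∃ z, (σ ⟨[x, y], rfl⟩).val = [x, z] := by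
      obtain ⟨p, q, h⟩ := List.length_eq_two.mp (σ ⟨[x, y], rfl⟩).property
      have hp := hπ ⟨[x, y], rfl⟩
      rw [h] at hp
      obtain rfl : p = x := by simpa using hp
      exact ⟨q, h⟩
    choose f hf using last_letter
    have hfadj (x y x' y' : Fin 3) :
        hanAdj [x, y] [x', y'] ↔ hanAdj [x, f x y] [x', f x' y'] := by
      simpa only [hf] using hadj ⟨[x, y], rfl⟩ ⟨[x', y'], rfl⟩
    simp only [hanAdj_pair_iff] at hfadj
    have f_inj (x : Fin 3) : Function.Injective (f x) := by
      intro y z h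
      have heq : σ ⟨[x, y], rfl⟩ = σ ⟨[x, z], rfl⟩ := Subtype.ext (by rw [hf, hf, h])
      simpa using σ.injective heq
    have f_self (x : Fin 3) : f x x = x := by
      obtain ⟨y, hy⟩ := Finite.surjective_of_injective (f_inj x) x
      by_cases hxy : x = y
      · rwa [← hxy] at hy
      · obtain ⟨z, hzx, hzy⟩ := exists_ne_and_ne x y
        have := (hfadj x y x z).mp (Or.inr ⟨rfl, hzy.symm, hxy, hzx.symm⟩)
        simp [hy] at this
    have f_eq (x y : Fin 3) : f x y = y := by
      by_cases hxy : x = y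
      · rw [hxy, f_self]
      · have := (hfadj x y y y).mp (Or.inl ⟨hxy, rfl⟩)
        simpa [hxy, f_self] using this
    rintro ⟨w, hw⟩
    obtain ⟨x, y, rfl⟩ := List.length_eq_two.mp hw
    exact Subtype.ext (by rw [hf, f_eq])
end

section
/- Let A₂ be the level-2 Schreier adjacency matrix of the Fabrykowski–Gupta group, i.e., the 9×9 integer matrix indexed by words of length 2 over {0,1,2} with A₂(u,v) = #{s ∈ {a,a⁻¹,b,b⁻¹} : s(u) = v}. Then, as an identity of polynomials in t over ℤ, det(I₉ − t·A₂ + 3t²·I₉) = (t−1)(3t−1)(3t²−t+1)⁴(9t⁴−6t³+t²−2t+1)². (This is the determinant factor in the Ihara–Bass formula for the Ihara zeta function of the level-2 Schreier graph Γ₂ of the Fabrykowski–Gupta group, computed via the Artin L-functions of the ℤ/3ℤ-Galois covering Γ₂|Γ₁.) -/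
/-- The generator `a` of the Fabrykowski–Gupta group: `a(xw)=((x+1) mod 3)·w`. -/
def fgA : List (Fin 3) → List (Fin 3)
  | [] => []
  | x :: w => (x + 1) :: w

/-- The inverse generator `a⁻¹`: `a⁻¹(xw)=((x-1) mod 3)·w`. -/
def fgAinv : List (Fin 3) → List (Fin 3)
  | [] => []
  | x :: w => (x - 1) :: w

/-- The generator `b`: `b(0w)=0·a(w)`, `b(1w)=1·b(w)`, `b(2w)=2·w`. -/
def fgB : List (Fin 3) → List (Fin 3)
  | [] => []
  | x :: w => if x = 0 then x :: fgA w else if x = 1 then x :: fgB w else x :: w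

/-- The inverse generator `b⁻¹`: `b⁻¹(0w)=0·a⁻¹(w)`, `b⁻¹(1w)=1·b⁻¹(w)`, `b⁻¹(2w)=2·w`. -/
def fgBinv : List (Fin 3) → List (Fin 3)
  | [] => []
  | x :: w => if x = 0 then x :: fgAinv w else if x = 1 then x :: fgBinv w else x :: w

open Polynomial

/-- The generating set `{a, a⁻¹, b, b⁻¹}` of the Fabrykowski–Gupta group. -/
def fgGens : List (List (Fin 3) → List (Fin 3)) := [fgA, fgAinv, fgB, fgBinv]

/-- The level-2 Schreier adjacency matrix `A₂` of the Fabrykowski–Gupta group, indexed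
by words `uv` of length 2 over `{0,1,2}`:
`A₂(u,v) = #{s ∈ {a,a⁻¹,b,b⁻¹} : s(u) = v}`. -/
def fgAdj2 : Matrix (Fin 3 × Fin 3) (Fin 3 × Fin 3) ℤ :=
  fun u v => (fgGens.countP (fun s => decide (s [u.1, u.2] = [v.1, v.2])) : ℤ)

/-- The adjacency matrix of a triangle. -/
noncomputable def triangleAdj : Matrix (Fin 3) (Fin 3) ℤ[X] :=
  !![0, 1, 1; 1, 0, 1; 1, 1, 0]

/-- The matrix `I₉ - t A₂ + 3 t² I₉` written by `3 × 3` blocks, according to the first letters of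
the words. The outer variable stands for `triangleAdj`. -/
noncomputable def iharaBlocks : Matrix (Fin 3) (Fin 3) ℤ[X][X] :=
  !![C (1 + 3 * X ^ 2) - C X * X, C (-X), C (-X);
    C (-X), C (1 - 2 * X + 3 * X ^ 2), C (-X);
    C (-X), C (-X), C (1 - 2 * X + 3 * X ^ 2)]

theorem fgAdj2_apply (i j k l : Fin 3) :
    fgAdj2 (i, j) (k, l) =
      if i = k then
        if i = 0 then (if j = l then 0 else 1) else (if j = l then 2 else 0)
      else if j = l then 1 else 0 := by
  revert i j k l
  decide

theorem comp_map_iharaBlocks :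
    Matrix.comp (Fin 3) (Fin 3) (Fin 3) (Fin 3) ℤ[X]
        (iharaBlocks.map (aeval triangleAdj : ℤ[X][X] →ₐ[ℤ[X]] _).toRingHom)
      = (1 : Matrix (Fin 3 × Fin 3) (Fin 3 × Fin 3) ℤ[X]) - (X : ℤ[X]) • (fgAdj2.map C)
        + (3 * X ^ 2 : ℤ[X]) • (1 : Matrix (Fin 3 × Fin 3) (Fin 3 × Fin 3) ℤ[X]) := by
  ext ⟨i, j⟩ ⟨k, l⟩ : 1
  simp only [Matrix.comp_apply, Matrix.add_apply, Matrix.sub_apply, Matrix.smul_apply,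
    Matrix.map_apply, fgAdj2_apply, Matrix.one_apply, Prod.mk.injEq, AlgHom.toRingHom_eq_coe,
    RingHom.coe_coe]
  fin_cases i <;> fin_cases k <;>
    simp only [iharaBlocks, Matrix.of_apply, Matrix.cons_val, Fin.mk_one, Fin.zero_eta,
      Fin.reduceFinMk, map_sub, aeval_C, aeval_X, map_mul, Matrix.sub_apply,
      ← Algebra.smul_def, Matrix.smul_apply, Matrix.algebraMap_matrix_apply] <;>
    fin_cases j <;> fin_cases l <;> simp [triangleAdj] <;> ring

theorem det_iharaBlocks :
    iharaBlocks.det =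
      C ((1 - X + 3 * X ^ 2) *
          ((1 + 3 * X ^ 2) * (1 - 3 * X + 3 * X ^ 2) - 2 * X ^ 2))
        - C ((1 - X + 3 * X ^ 2) * X * (1 - 3 * X + 3 * X ^ 2)) * X := by
  simp only [iharaBlocks, Matrix.det_fin_three, Matrix.of_apply, Matrix.cons_val, map_sub, map_add, map_mul, map_one, map_pow, map_neg, map_ofNat]
  ring

/-- The determinant factor in the Ihara–Bass formula for the Ihara zeta function of
the level-2 Schreier graph `Γ₂` of the Fabrykowski–Gupta group:
`det(I₉ − t·A₂ + 3t²·I₉) = (t−1)(3t−1)(3t²−t+1)⁴(9t⁴−6t³+t²−2t+1)²`. -/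
theorem fabrykowskiGupta_level2_ihara_det :
    Matrix.det
      ((1 : Matrix (Fin 3 × Fin 3) (Fin 3 × Fin 3) (Polynomial ℤ))
        - (X : Polynomial ℤ) • (fgAdj2.map C)
        + (3 * X ^ 2 : Polynomial ℤ) •
            (1 : Matrix (Fin 3 × Fin 3) (Fin 3 × Fin 3) (Polynomial ℤ)))
      = (X - 1) * (3 * X - 1) * (3 * X ^ 2 - X + 1) ^ 4
        * (9 * X ^ 4 - 6 * X ^ 3 + X ^ 2 - 2 * X + 1) ^ 2 := by
  rw [← comp_map_iharaBlocks, ← Matrix.det_det, det_iharaBlocks]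
  simp only [AlgHom.toRingHom_eq_coe, RingHom.coe_coe, map_sub, aeval_C, aeval_X, map_mul (aeval _),
    ← Algebra.smul_def]
  rw [Matrix.det_fin_three]
  simp only [Matrix.sub_apply, Matrix.smul_apply, Matrix.algebraMap_matrix_apply]
  simp [triangleAdj]
  ring
end

section
/- Let A₃ be the level-3 Schreier adjacency matrix of the linear-automaton group, i.e., the 8×8 integer matrix indexed by binary words of length 3 with A₃(u,v) = #{s ∈ {a,a⁻¹,b,b⁻¹} : s(u) = v}. Then, as an identity of polynomials in t over ℤ, det(I₈ − t·A₃ + 3t²·I₈) = (t−1)(3t−1)(3t²+1)(3t²−2t+1)(3t²+2t+1)(9t⁴−6t³+4t²−2t+1)(9t⁴+6t³+4t²+2t+1). (This is the determinant factor in the Ihara–Bass formula for the Ihara zeta function of the level-3 Schreier graph Γ₃ of the linear-automaton group, computed via the Artin L-functions of the ℤ/2ℤ-Galois covering Γ₃|Γ₂.) -/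
/-- The generator `a` of the linear-automaton group: `a(0w)=1·a(w)`, `a(1w)=0·w`. -/
def linA : List (Fin 2) → List (Fin 2)
  | [] => []
  | x :: w => if x = 0 then 1 :: linA w else 0 :: w

/-- The inverse generator `a⁻¹`: `a⁻¹(1w)=0·a⁻¹(w)`, `a⁻¹(0w)=1·w`. -/
def linAinv : List (Fin 2) → List (Fin 2)
  | [] => []
  | x :: w => if x = 1 then 0 :: linAinv w else 1 :: w

/-- The generator `b`: `b(0w)=0·b(w)`, `b(1w)=1·a(w)`. -/
def linB : List (Fin 2) → List (Fin 2)
  | [] => []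
  | x :: w => if x = 0 then 0 :: linB w else 1 :: linA w

/-- The inverse generator `b⁻¹`: `b⁻¹(0w)=0·b⁻¹(w)`, `b⁻¹(1w)=1·a⁻¹(w)`. -/
def linBinv : List (Fin 2) → List (Fin 2)
  | [] => []
  | x :: w => if x = 0 then 0 :: linBinv w else 1 :: linAinv w

open Polynomial

/-- The generating set `{a, a⁻¹, b, b⁻¹}` of the linear-automaton group. -/
def linGens : List (List (Fin 2) → List (Fin 2)) := [linA, linAinv, linB, linBinv]

/-- The level-3 Schreier adjacency matrix `A₃` of the linear-automaton group, indexed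
by binary words `u₁u₂u₃` of length 3:
`A₃(u,v) = #{s ∈ {a,a⁻¹,b,b⁻¹} : s(u) = v}`. -/
def linAdj3 : Matrix (Fin 2 × Fin 2 × Fin 2) (Fin 2 × Fin 2 × Fin 2) ℤ :=
  fun u v =>
    (linGens.countP (fun s => decide (s [u.1, u.2.1, u.2.2] = [v.1, v.2.1, v.2.2])) : ℤ)

/-- The determinant of a block matrix invariant under swapping its two blocks splits into a
symmetric and an antisymmetric factor. -/
theorem Matrix.det_fromBlocks_self_swap {m R : Type*} [Fintype m] [DecidableEq m] [CommRing R]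
    (A B : Matrix m m R) :
    (Matrix.fromBlocks A B B A).det = (A + B).det * (A - B).det := by
  have h : Matrix.fromBlocks 1 1 0 1 * Matrix.fromBlocks A B B A * Matrix.fromBlocks 1 (-1) 0 1
      = Matrix.fromBlocks (A + B) 0 B (A - B) := by
    simp [Matrix.fromBlocks_multiply, sub_eq_add_neg, add_comm]
    abel
  simpa [Matrix.det_mul] using congrArg Matrix.det h

/-- The binary words of length 3, split into two sheets by their last letter. -/
def wordsByLastLetter : Fin 4 ⊕ Fin 4 ≃ Fin 2 × Fin 2 × Fin 2 where
  toFun := Sum.elim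
    ![(0, 0, 0), (0, 1, 0), (1, 0, 0), (1, 1, 0)] ![(0, 0, 1), (0, 1, 1), (1, 0, 1), (1, 1, 1)]
  invFun u := if u.2.2 = 0 then .inl (finProdFinEquiv (u.1, u.2.1))
    else .inr (finProdFinEquiv (u.1, u.2.1))
  left_inv := by decide
  right_inv := by decide

/-- The edges of `Γ₃` joining words with the same last letter. -/
def sameSheetAdj : Matrix (Fin 4) (Fin 4) ℤ :=
  !![2, 0, 1, 0; 0, 0, 1, 1; 1, 1, 0, 1; 0, 1, 1, 0]

/-- The edges of `Γ₃` joining words with different last letters. -/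
def otherSheetAdj : Matrix (Fin 4) (Fin 4) ℤ :=
  !![0, 0, 0, 1; 0, 2, 0, 0; 0, 0, 0, 1; 1, 0, 1, 0]

theorem linAdj3_submatrix :
    linAdj3.submatrix wordsByLastLetter wordsByLastLetter
      = Matrix.fromBlocks sameSheetAdj otherSheetAdj otherSheetAdj sameSheetAdj := by
  decide

/-- The determinant factor in the Ihara–Bass formula for the Ihara zeta function of
the level-3 Schreier graph `Γ₃` of the linear-automaton group:
`det(I₈ − t·A₃ + 3t²·I₈) =
(t−1)(3t−1)(3t²+1)(3t²−2t+1)(3t²+2t+1)(9t⁴−6t³+4t²−2t+1)(9t⁴+6t³+4t²+2t+1)`. -/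
theorem linearAutomaton_level3_ihara_det :
    Matrix.det
      ((1 : Matrix (Fin 2 × Fin 2 × Fin 2) (Fin 2 × Fin 2 × Fin 2) (Polynomial ℤ))
        - (X : Polynomial ℤ) • (linAdj3.map C)
        + (3 * X ^ 2 : Polynomial ℤ) •
            (1 : Matrix (Fin 2 × Fin 2 × Fin 2) (Fin 2 × Fin 2 × Fin 2) (Polynomial ℤ)))
      = (X - 1) * (3 * X - 1) * (3 * X ^ 2 + 1) * (3 * X ^ 2 - 2 * X + 1)
        * (3 * X ^ 2 + 2 * X + 1) * (9 * X ^ 4 - 6 * X ^ 3 + 4 * X ^ 2 - 2 * X + 1)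
        * (9 * X ^ 4 + 6 * X ^ 3 + 4 * X ^ 2 + 2 * X + 1) := by
  rw [← Matrix.det_submatrix_equiv_self wordsByLastLetter]
  have h : ((1 : Matrix (Fin 2 × Fin 2 × Fin 2) (Fin 2 × Fin 2 × Fin 2) (Polynomial ℤ))
        - (X : Polynomial ℤ) • (linAdj3.map C)
        + (3 * X ^ 2 : Polynomial ℤ) •
            (1 : Matrix (Fin 2 × Fin 2 × Fin 2) (Fin 2 × Fin 2 × Fin 2) (Polynomial ℤ))).submatrix
          wordsByLastLetter wordsByLastLetter
      = (1 : Matrix (Fin 4 ⊕ Fin 4) (Fin 4 ⊕ Fin 4) (Polynomial ℤ))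
        - (X : Polynomial ℤ) •
          ((linAdj3.submatrix wordsByLastLetter wordsByLastLetter).map C)
        + (3 * X ^ 2 : Polynomial ℤ) • 1 := by
    simp [Matrix.submatrix_add, Matrix.submatrix_sub, Matrix.submatrix_smul, Matrix.submatrix_map]
  rw [h, linAdj3_submatrix, Matrix.fromBlocks_map, ← Matrix.fromBlocks_one, Matrix.fromBlocks_smul,
    Matrix.fromBlocks_smul, sub_eq_add_neg, Matrix.fromBlocks_neg, Matrix.fromBlocks_add,
    Matrix.fromBlocks_add]
  simp only [zero_add, smul_zero, add_zero]
  rw [Matrix.det_fromBlocks_self_swap]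
  simp only [sameSheetAdj, otherSheetAdj]
  simp [Matrix.det_succ_row_zero, Fin.sum_univ_succ, Matrix.one_apply, Fin.succAbove]
  ring
end
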